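/- arXiv:2505.24555 — 3 statements merged into one kernel-verified Lean document; each statement's English description precedes it below -/
import Mathlib

section
/- Let R = (C, Δ) be a generalized root system for a connected basic datum (X, ρ). The following statements are equivalent: (a) R is finite, i.e. the Weyl groupoid W(R) is a finite set; (b) |Δ^x| < ∞ for all x ∈ X; (c) there exists x ∈ X such that |Δ^x| < ∞; (d) |(Δ^re)^x| < ∞ for all x ∈ X. -/
open Function

/-- The reflection `s_i` determined by the `i`-th row of a generalized Cartan matrix `C`,
acting on `ℤ^θ`; on the standard basis it is `s_i(α_j) = α_j - C i j • α_i`. -/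
def cartanRefl {θ : ℕ} (C : Matrix (Fin θ) (Fin θ) ℤ) (i : Fin θ) :
    (Fin θ → ℤ) → (Fin θ → ℤ) :=
  fun v => v - (∑ j, C i j * v j) • Pi.single i 1

/-- A generalized root system `(C, Δ)` over a connected basic datum `(X, ρ)`. -/
structure GRS (θ : ℕ) (X : Type*) where
  nonempty : Nonempty X
  /-- The basic datum: a family of involutive permutations of `X`. -/
  ρ : Fin θ → Equiv.Perm X
  ρ_invol : ∀ i, ρ i * ρ i = 1
  /-- Connectedness of the basic datum. -/
  connected : ∀ x y : X, Relation.ReflTransGen (fun a b => ∃ i, ρ i a = b) x y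
  /-- The Cartan datum: a bundle of generalized Cartan matrices. -/
  C : X → Matrix (Fin θ) (Fin θ) ℤ
  C_diag : ∀ x i, C x i i = 2
  C_offdiag : ∀ x i j, i ≠ j → C x i j ≤ 0
  C_zero_iff : ∀ x i j, i ≠ j → (C x i j = 0 ↔ C x j i = 0)
  C_compat : ∀ x i j, C (ρ i x) i j = C x i j
  /-- The bundle of root sets. -/
  Δ : X → Set (Fin θ → ℤ)
  /-- Axiom (1): `Δ^x = Δ^x_+ ∪ Δ^x_-`, where `Δ^x_± = ±(Δ^x ∩ ℕ₀^θ)`. -/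
  root_pos_neg : ∀ x, Δ x = (Δ x ∩ {v | ∀ k, 0 ≤ v k}) ∪ ((fun v => -v) '' (Δ x ∩ {v | ∀ k, 0 ≤ v k}))
  /-- Axiom (2): `Δ^x ∩ ℤα_i = {α_i, -α_i}`. -/
  root_simple : ∀ x i, Δ x ∩ {v | ∃ n : ℤ, v = n • (Pi.single i 1 : Fin θ → ℤ)}
      = {Pi.single i 1, -Pi.single i 1}
  /-- Axiom (3): `s_i^x(Δ^x) = Δ^{ρ_i(x)}`. -/
  root_refl : ∀ x i, cartanRefl (C x) i '' Δ x = Δ (ρ i x)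
  /-- Axiom (4): `(ρ_i ρ_j)^{m^x_{ij}}(x) = x` where `m^x_{ij} = |Δ^x ∩ (ℕ₀α_i + ℕ₀α_j)|`. -/
  root_coxeter : ∀ x i j, i ≠ j →
    (Δ x ∩ {v | ∃ p q : ℕ, v = p • (Pi.single i 1 : Fin θ → ℤ) + q • Pi.single j 1}).Finite →
    ((ρ i * ρ j) ^
      (Δ x ∩ {v | ∃ p q : ℕ, v = p • (Pi.single i 1 : Fin θ → ℤ) + q • Pi.single j 1}).ncard) x = x

namespace GRS

variable {θ : ℕ} {X : Type*} (R : GRS θ X)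

/-- The set of positive roots `Δ^x_+` at `x`. -/
def pos (x : X) : Set (Fin θ → ℤ) := {v ∈ R.Δ x | ∀ k, 0 ≤ v k}

/-- Membership in the Weyl groupoid `W(R)`: `Weyl R x g y` says that the triple `(x, g, y)`
belongs to the subgroupoid of `X × GL(ℤ^θ) × X` generated by the `ς_i^x = (x, s_i^x, ρ_i(x))`. -/
inductive Weyl : X → ((Fin θ → ℤ) → (Fin θ → ℤ)) → X → Prop
  | nil (x : X) : Weyl x _root_.id x
  | cons (x : X) (i : Fin θ) {g : (Fin θ → ℤ) → (Fin θ → ℤ)} {y : X} :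
      Weyl (R.ρ i x) g y → Weyl x (cartanRefl (R.C x) i ∘ g) y

/-- Endpoint of the word `ς_{i_1}^x ς_{i_2} ⋯ ς_{i_t}` (with implicit superscripts). -/
def wordEnd : X → List (Fin θ) → X
  | x, [] => x
  | x, i :: l => wordEnd (R.ρ i x) l

/-- The element of `GL(ℤ^θ)` given by the word `ς_{i_1}^x ς_{i_2} ⋯ ς_{i_t}`:
the composition `s_{i_1}^x ∘ s_{i_2}^{ρ_{i_1}(x)} ∘ ⋯`. -/
def wordMap : X → List (Fin θ) → ((Fin θ → ℤ) → (Fin θ → ℤ))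
  | _, [] => _root_.id
  | x, i :: l => cartanRefl (R.C x) i ∘ wordMap (R.ρ i x) l

/-- The length `ℓ(w)` of the element `w = (x, g, y)` of the Weyl groupoid: the least number of
generators needed to express it. -/
noncomputable def len (x : X) (g : (Fin θ → ℤ) → (Fin θ → ℤ)) (y : X) : ℕ :=
  sInf {t | ∃ l : List (Fin θ), l.length = t ∧ R.wordEnd x l = y ∧ R.wordMap x l = g}

/-- The set of real roots `(Δ^{re})^x` at `x`. -/
def realRoots (x : X) : Set (Fin θ → ℤ) :=
  {v | ∃ (i : Fin θ) (g : (Fin θ → ℤ) → (Fin θ → ℤ)) (y : X), R.Weyl x g y ∧ v = g (Pi.single i 1)}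

/-- The generalized root system is finite: its Weyl groupoid is a finite set. -/
def FiniteWeyl : Prop :=
  {p : X × ((Fin θ → ℤ) → (Fin θ → ℤ)) × X | R.Weyl p.1 p.2.1 p.2.2}.Finite

end GRS

theorem cartanRefl_apply_of_ne {θ : ℕ} (C : Matrix (Fin θ) (Fin θ) ℤ) {i k : Fin θ} (h : k ≠ i)
    (v : Fin θ → ℤ) : cartanRefl C i v k = v k := by
  simp [cartanRefl, h]

theorem cartanRefl_single {θ : ℕ} (C : Matrix (Fin θ) (Fin θ) ℤ) (i j : Fin θ) :
    cartanRefl C i (Pi.single j 1) = Pi.single j 1 - C i j • Pi.single i 1 := by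
  simp [cartanRefl, Pi.single_apply]

/-- The reflection `s_i` as a linear map. -/
def cartanReflLinear {θ : ℕ} (C : Matrix (Fin θ) (Fin θ) ℤ) (i : Fin θ) :
    (Fin θ → ℤ) →ₗ[ℤ] (Fin θ → ℤ) where
  toFun := cartanRefl C i
  map_add' u v := by
    simp only [cartanRefl, Pi.add_apply, mul_add, Finset.sum_add_distrib, add_smul]
    abel
  map_smul' c v := by
    simp only [cartanRefl, Pi.smul_apply, smul_eq_mul, RingHom.id_apply, smul_sub, smul_smul,
      Finset.mul_sum]
    congr! 3
    ring

theorem cartanRefl_involutive {θ : ℕ} (C : Matrix (Fin θ) (Fin θ) ℤ) (i : Fin θ) (h : C i i = 2) :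
    Involutive (cartanRefl C i) := by
  have : cartanReflLinear C i ∘ₗ cartanReflLinear C i = LinearMap.id := by
    refine LinearMap.pi_ext' fun j => LinearMap.ext_ring ?_
    change cartanReflLinear C i (cartanRefl C i (Pi.single j 1)) = Pi.single j 1
    rw [cartanRefl_single, map_sub, map_zsmul]
    change cartanRefl C i _ - _ • cartanRefl C i _ = _
    rw [cartanRefl_single, cartanRefl_single, h]
    module
  exact fun v => LinearMap.congr_fun this v

namespace GRS

variable {θ : ℕ} {X : Type*} (R : GRS θ X)

/-- The reflection `s_i^x` as a linear automorphism. -/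
def simpleRefl (x : X) (i : Fin θ) : (Fin θ → ℤ) ≃ₗ[ℤ] (Fin θ → ℤ) :=
  LinearEquiv.ofInvolutive (cartanReflLinear (R.C x) i) (cartanRefl_involutive _ i (R.C_diag x i))

@[simp]
theorem coe_simpleRefl (x : X) (i : Fin θ) : ⇑(R.simpleRefl x i) = cartanRefl (R.C x) i := rfl

theorem simpleRefl_mul_self (x : X) (i : Fin θ) : R.simpleRefl x i * R.simpleRefl x i = 1 :=
  LinearEquiv.ext (cartanRefl_involutive _ i (R.C_diag x i))

@[simp]
theorem simpleRefl_ρ (x : X) (i : Fin θ) : R.simpleRefl (R.ρ i x) i = R.simpleRefl x i := by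
  ext1 v
  simp [cartanRefl, R.C_compat]

@[simp]
theorem ρ_ρ (x : X) (i : Fin θ) : R.ρ i (R.ρ i x) = x := by
  rw [← Equiv.Perm.mul_apply, R.ρ_invol, Equiv.Perm.one_apply]

theorem simpleRefl_single_self (x : X) (i : Fin θ) :
    R.simpleRefl x i (Pi.single i 1) = -Pi.single i 1 := by
  rw [coe_simpleRefl, cartanRefl_single, R.C_diag]
  module

theorem simpleRefl_single (x : X) (i j : Fin θ) :
    R.simpleRefl x i (Pi.single j 1) = Pi.single j 1 - R.C x i j • Pi.single i 1 := by
  rw [coe_simpleRefl, cartanRefl_single]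

theorem simpleRefl_apply_of_ne (x : X) {i k : Fin θ} (h : k ≠ i) (v : Fin θ → ℤ) :
    R.simpleRefl x i v k = v k :=
  cartanRefl_apply_of_ne _ h v

section Roots

variable {R} {x y : X} {v : Fin θ → ℤ}

theorem neg_mem (hv : v ∈ R.Δ x) : -v ∈ R.Δ x := by
  rw [R.root_pos_neg] at hv ⊢
  rcases hv with h | ⟨w, h, rfl⟩
  · exact Or.inr ⟨v, h, rfl⟩
  · simpa using Or.inl h

theorem nonneg_or_nonpos (hv : v ∈ R.Δ x) : 0 ≤ v ∨ v ≤ 0 := by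
  rw [R.root_pos_neg] at hv
  rcases hv with h | ⟨w, h, rfl⟩
  · exact Or.inl h.2
  · exact Or.inr (neg_nonpos.2 h.2)

variable (R) in
theorem single_mem (x : X) (i : Fin θ) : Pi.single i 1 ∈ R.Δ x := by
  have : (Pi.single i 1 : Fin θ → ℤ) ∈ ({Pi.single i 1, -Pi.single i 1} : Set _) := Or.inl rfl
  rw [← R.root_simple x i] at this
  exact this.1

theorem single_pos (i : Fin θ) : (0 : Fin θ → ℤ) < Pi.single i 1 := by simp

theorem eq_zsmul_single {i : Fin θ} (h : ∀ k, k ≠ i → v k = 0) : v = v i • Pi.single i 1 := by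
  ext k
  by_cases hk : k = i
  · subst hk; simp
  · simp [hk, h k hk]

theorem eq_single_of_support {i : Fin θ} (hv : v ∈ R.Δ x) (h0 : 0 ≤ v)
    (h : ∀ k, k ≠ i → v k = 0) : v = Pi.single i 1 := by
  have : v ∈ ({Pi.single i 1, -Pi.single i 1} : Set _) := by
    rw [← R.root_simple x i]
    exact ⟨hv, _, eq_zsmul_single h⟩
  rcases this with h | h
  · exact h
  · have := h0 i
    rw [h] at this
    simp at this

theorem ne_zero_of_mem (i : Fin θ) (hv : v ∈ R.Δ x) : v ≠ 0 := by
  rintro rfl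
  have := eq_single_of_support (i := i) hv le_rfl (by simp)
  exact (single_pos i).ne this

theorem simpleRefl_mem (i : Fin θ) (hv : v ∈ R.Δ x) : R.simpleRefl x i v ∈ R.Δ (R.ρ i x) := by
  rw [← R.root_refl]
  exact ⟨v, hv, rfl⟩

/-- A simple reflection sends every positive root but the corresponding simple root to a
positive root. -/
theorem simpleRefl_nonneg {i : Fin θ} (hv : v ∈ R.Δ x) (h0 : 0 ≤ v) (hne : v ≠ Pi.single i 1) :
    0 ≤ R.simpleRefl x i v := by
  refine (nonneg_or_nonpos (simpleRefl_mem i hv)).resolve_right fun h => hne ?_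
  refine eq_single_of_support hv h0 fun k hk => le_antisymm ?_ (h0 k)
  rw [← R.simpleRefl_apply_of_ne x hk v]
  exact h k

end Roots

/-- `R.Mor J n x g y` says that `(x, g, y)` is a product of `n` generators of the Weyl groupoid
with labels in `J`. -/
inductive Mor (J : Set (Fin θ)) : ℕ → X → ((Fin θ → ℤ) ≃ₗ[ℤ] (Fin θ → ℤ)) → X → Prop
  | nil (x : X) : Mor J 0 x 1 x
  | snoc {n : ℕ} {x y : X} {g : (Fin θ → ℤ) ≃ₗ[ℤ] (Fin θ → ℤ)} {i : Fin θ} (hi : i ∈ J) :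
      Mor J n x g y → Mor J (n + 1) x (g * R.simpleRefl y i) (R.ρ i y)

/-- The positive roots with support in `J` that are made negative by `g`. -/
def inversions (J : Set (Fin θ)) (g : (Fin θ → ℤ) → (Fin θ → ℤ)) (y : X) : Set (Fin θ → ℤ) :=
  {v ∈ R.Δ y | 0 ≤ v ∧ (∀ k, k ∉ J → v k = 0) ∧ g v ≤ 0}

section Mor

variable {R} {J : Set (Fin θ)} {m n : ℕ} {x y z : X} {g h : (Fin θ → ℤ) ≃ₗ[ℤ] (Fin θ → ℤ)}

theorem Mor.trans (hg : R.Mor J m x g y) (hh : R.Mor J n y h z) : R.Mor J (m + n) x (g * h) z := by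
  induction hh with
  | nil => simpa using hg
  | snoc hi _ ih => rw [← mul_assoc]; exact (ih hg).snoc hi

theorem Mor.mono {K : Set (Fin θ)} (hJK : J ⊆ K) (hg : R.Mor J n x g y) : R.Mor K n x g y := by
  induction hg with
  | nil => exact .nil _
  | snoc hi _ ih => exact ih.snoc (hJK hi)

theorem Mor.single {i : Fin θ} (hi : i ∈ J) : R.Mor J 1 x (R.simpleRefl x i) (R.ρ i x) := by
  simpa using (Mor.nil (R := R) x).snoc hi

theorem Mor.symm (hg : R.Mor J n x g y) : R.Mor J n y g⁻¹ x := by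
  induction hg with
  | nil => simpa using Mor.nil _
  | @snoc n x y g i hi _ ih =>
    have h1 := (Mor.single (R := R) (x := R.ρ i y) hi)
    rw [ρ_ρ, simpleRefl_ρ] at h1
    rw [mul_inv_rev, ← eq_inv_of_mul_eq_one_left (R.simpleRefl_mul_self y i), add_comm]
    exact h1.trans ih

theorem Mor.map_mem (hg : R.Mor J n x g y) {v : Fin θ → ℤ} (hv : v ∈ R.Δ y) : g v ∈ R.Δ x := by
  induction hg generalizing v with
  | nil => exact hv
  | @snoc _ _ _ _ i hi _ ih =>
    refine ih ?_
    have := simpleRefl_mem i hv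
    rwa [ρ_ρ, simpleRefl_ρ] at this

theorem Mor.apply_of_notMem (hg : R.Mor J n x g y) {k : Fin θ} (hk : k ∉ J) (v : Fin θ → ℤ) :
    g v k = v k := by
  induction hg generalizing v with
  | nil => rfl
  | snoc hi _ ih =>
    rw [LinearEquiv.mul_apply, ih, R.simpleRefl_apply_of_ne]
    rintro rfl
    exact hk hi

theorem mul_simpleRefl_mul_simpleRefl (y : X) (g : (Fin θ → ℤ) ≃ₗ[ℤ] (Fin θ → ℤ)) (i : Fin θ) :
    g * R.simpleRefl y i * R.simpleRefl (R.ρ i y) i = g := by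
  rw [simpleRefl_ρ, mul_assoc, simpleRefl_mul_self, mul_one]

theorem not_nonneg_of_nonpos (i : Fin θ) {v : Fin θ → ℤ} (hv : v ∈ R.Δ x) (h : v ≤ 0) : ¬0 ≤ v :=
  fun h' => ne_zero_of_mem i hv (le_antisymm h h')

/-- Appending `s_i` to `g` with `g α_i` positive adds exactly one inversion. -/
theorem Mor.inversions_snoc (hg : R.Mor Set.univ n x g y) {i : Fin θ} (hi : i ∈ J)
    (h0 : 0 ≤ g (Pi.single i 1)) :
    R.inversions J (g * R.simpleRefl y i : (Fin θ → ℤ) ≃ₗ[ℤ] (Fin θ → ℤ)) (R.ρ i y) =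
      insert (Pi.single i 1) (R.simpleRefl y i '' R.inversions J g y) := by
  have hs (v) : R.simpleRefl y i (R.simpleRefl y i v) = v :=
    LinearEquiv.congr_fun (R.simpleRefl_mul_self y i) v
  have hi' (k) (hk : k ∉ J) : k ≠ i := by rintro rfl; exact hk hi
  ext v
  constructor
  · rintro ⟨hv, hv0, hJ, hneg⟩
    refine or_iff_not_imp_left.2 fun hne => ⟨R.simpleRefl y i v, ⟨?_, ?_, ?_, hneg⟩, hs v⟩
    · simpa using simpleRefl_mem i hv
    · simpa using simpleRefl_nonneg hv hv0 hne
    · intro k hk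
      rw [R.simpleRefl_apply_of_ne y (hi' k hk), hJ k hk]
  · rintro (rfl | ⟨v, ⟨hv, hv0, hJ, hneg⟩, rfl⟩)
    · refine ⟨R.single_mem _ i, (single_pos i).le, fun k hk => by simp [hi' k hk], ?_⟩
      rw [LinearEquiv.mul_apply, simpleRefl_single_self, map_neg]
      exact neg_nonpos.2 h0
    · refine ⟨simpleRefl_mem i hv, simpleRefl_nonneg hv hv0 ?_, ?_, ?_⟩
      · rintro rfl
        exact not_nonneg_of_nonpos i (hg.map_mem hv) hneg h0
      · intro k hk
        rw [R.simpleRefl_apply_of_ne y (hi' k hk), hJ k hk]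
      · rwa [LinearEquiv.mul_apply, hs]

theorem single_notMem_image_inversions {i : Fin θ} :
    Pi.single i 1 ∉ R.simpleRefl y i '' R.inversions J g y := by
  rintro ⟨v, ⟨hv, hv0, -, -⟩, h⟩
  have : v = -Pi.single i 1 := by
    rw [← simpleRefl_single_self, ← h]
    exact (LinearEquiv.congr_fun (R.simpleRefl_mul_self y i) v).symm
  rw [this] at hv0
  exact absurd (hv0 i) (by simp)

theorem Mor.map_single_nonneg_or_nonpos (hg : R.Mor Set.univ n x g y) (i : Fin θ) :
    0 ≤ g (Pi.single i 1) ∨ g (Pi.single i 1) ≤ 0 :=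
  nonneg_or_nonpos (hg.map_mem (R.single_mem y i))

theorem mul_simpleRefl_single (y : X) (g : (Fin θ → ℤ) ≃ₗ[ℤ] (Fin θ → ℤ)) (i : Fin θ) :
    (g * R.simpleRefl y i) (Pi.single i 1) = -g (Pi.single i 1) := by
  rw [LinearEquiv.mul_apply, simpleRefl_single_self, map_neg]

theorem Mor.inversions_of_nonpos (hg : R.Mor Set.univ n x g y) {i : Fin θ} (hi : i ∈ J)
    (h0 : g (Pi.single i 1) ≤ 0) :
    R.inversions J g y = insert (Pi.single i 1) (R.simpleRefl (R.ρ i y) i ''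
      R.inversions J (g * R.simpleRefl y i : (Fin θ → ℤ) ≃ₗ[ℤ] (Fin θ → ℤ)) (R.ρ i y)) := by
  have := (hg.snoc (Set.mem_univ i)).inversions_snoc hi
    (by rw [mul_simpleRefl_single]; exact neg_nonneg.2 h0)
  rwa [mul_simpleRefl_mul_simpleRefl, ρ_ρ] at this

theorem Mor.finite_inversions (hg : R.Mor Set.univ n x g y) :
    (R.inversions Set.univ g y).Finite := by
  induction hg with
  | nil x =>
    rcases isEmpty_or_nonempty (Fin θ) with h | ⟨⟨i⟩⟩
    · exact Set.toFinite _
    · convert Set.finite_empty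
      refine Set.eq_empty_of_forall_notMem fun v ⟨hv, hv0, _, hv'⟩ => ?_
      exact not_nonneg_of_nonpos i hv hv' hv0
  | @snoc n x y g i hi hg ih =>
    rcases hg.map_single_nonneg_or_nonpos i with h | h
    · rw [hg.inversions_snoc hi h]
      exact (ih.image _).insert _
    · rw [hg.inversions_of_nonpos hi h] at ih
      exact (ih.subset (Set.subset_insert _ _)).of_finite_image
        (LinearEquiv.injective _).injOn

theorem Mor.finite_inversions' (hg : R.Mor Set.univ n x g y) : (R.inversions J g y).Finite :=
  hg.finite_inversions.subset fun _ ⟨h1, h2, _, h4⟩ => ⟨h1, h2, fun _ hk => (hk trivial).elim, h4⟩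

theorem Mor.ncard_inversions_snoc (hg : R.Mor Set.univ n x g y) {i : Fin θ} (hi : i ∈ J)
    (h0 : 0 ≤ g (Pi.single i 1)) :
    (R.inversions J (g * R.simpleRefl y i : (Fin θ → ℤ) ≃ₗ[ℤ] (Fin θ → ℤ)) (R.ρ i y)).ncard =
      (R.inversions J g y).ncard + 1 := by
  rw [hg.inversions_snoc hi h0, Set.ncard_insert_of_notMem single_notMem_image_inversions
    (hg.finite_inversions'.image _), Set.ncard_image_of_injective _ (LinearEquiv.injective _)]

theorem Mor.ncard_inversions_of_nonpos (hg : R.Mor Set.univ n x g y) {i : Fin θ} (hi : i ∈ J)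
    (h0 : g (Pi.single i 1) ≤ 0) :
    (R.inversions J g y).ncard =
      (R.inversions J (g * R.simpleRefl y i : (Fin θ → ℤ) ≃ₗ[ℤ] (Fin θ → ℤ)) (R.ρ i y)).ncard
        + 1 := by
  have := (hg.snoc (Set.mem_univ i)).ncard_inversions_snoc hi
    (by rw [mul_simpleRefl_single]; exact neg_nonneg.2 h0)
  rwa [mul_simpleRefl_mul_simpleRefl, ρ_ρ] at this

end Mor

section RankTwo

/-- The alternating product `⋯ * a * b * a` with `n` factors. -/
def altProd {G : Type*} [Monoid G] (a b : G) : ℕ → G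
  | 0 => 1
  | n + 1 => altProd b a n * a

theorem altProd_succ_left {G : Type*} [Monoid G] (a b : G) (n : ℕ) :
    altProd a b (n + 1) = (if Even n then a else b) * altProd a b n := by
  induction n generalizing a b with
  | zero => simp [altProd]
  | succ n ih =>
    rw [altProd, ih b a, altProd, mul_assoc]
    congr 1
    by_cases h : Even n <;> simp [h, Nat.even_add_one]

theorem altProd_inv_mul {G : Type*} [Group G] {a b : G} (ha : a * a = 1) (hb : b * b = 1) (n : ℕ) :
    (altProd b a n)⁻¹ * altProd a b n = (b * a) ^ n := by
  induction n generalizing a b with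
  | zero => simp [altProd]
  | succ n ih =>
    have hb' : b⁻¹ = b := inv_eq_of_mul_eq_one_left hb
    calc (altProd b a (n + 1))⁻¹ * altProd a b (n + 1)
        = b * ((altProd a b n)⁻¹ * altProd b a n) * a := by
          simp only [altProd, mul_inv_rev, hb', mul_assoc]
      _ = b * (a * b) ^ n * a := by rw [ih hb ha]
      _ = (b * a) ^ (n + 1) := by rw [mul_assoc, mul_pow_mul, ← mul_assoc, pow_succ']

variable {R} {n : ℕ} {x y : X} {i j : Fin θ} {g : (Fin θ → ℤ) ≃ₗ[ℤ] (Fin θ → ℤ)} {v : Fin θ → ℤ}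

/-- Passing from `(x, g, y)` to the shorter element `(x, g, y) ς_i`, where `g α_i` is negative. -/
inductive Descent (R : GRS θ X) :
    X × ((Fin θ → ℤ) ≃ₗ[ℤ] (Fin θ → ℤ)) → X × ((Fin θ → ℤ) ≃ₗ[ℤ] (Fin θ → ℤ)) → Prop
  | mk (y : X) (g : (Fin θ → ℤ) ≃ₗ[ℤ] (Fin θ → ℤ)) (i : Fin θ) (h : g (Pi.single i 1) ≤ 0) :
      R.Descent (y, g) (R.ρ i y, g * R.simpleRefl y i)

variable (R) in
/-- The positive roots in the span of `α_i` and `α_j`. -/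
def posPair (i j : Fin θ) (y : X) : Set (Fin θ → ℤ) :=
  {v ∈ R.Δ y | 0 ≤ v ∧ ∀ k, k ∉ ({i, j} : Set (Fin θ)) → v k = 0}

theorem eq_smul_add_smul (hij : i ≠ j) (hv : ∀ k, k ∉ ({i, j} : Set (Fin θ)) → v k = 0) :
    v = v i • Pi.single i 1 + v j • Pi.single j 1 := by
  ext k
  by_cases hi : k = i
  · subst hi; simp [hij]
  by_cases hj : k = j
  · subst hj; simp [hij.symm]
  simp [hi, hj, hv]

theorem map_nonpos_of_support (hij : i ≠ j) (hi : g (Pi.single i 1) ≤ 0)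
    (hj : g (Pi.single j 1) ≤ 0) (hv : ∀ k, k ∉ ({i, j} : Set (Fin θ)) → v k = 0) (h0 : 0 ≤ v) :
    g v ≤ 0 := by
  rw [eq_smul_add_smul hij hv, map_add, map_smul, map_smul]
  exact add_nonpos (smul_nonpos_of_nonneg_of_nonpos (h0 i) hi)
    (smul_nonpos_of_nonneg_of_nonpos (h0 j) hj)

theorem posPair_eq (hij : i ≠ j) (y : X) : R.posPair i j y =
    R.Δ y ∩ {v | ∃ p q : ℕ, v = p • (Pi.single i 1 : Fin θ → ℤ) + q • Pi.single j 1} := by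
  ext v
  refine and_congr_right fun _ => ⟨fun ⟨h0, hv⟩ => ⟨(v i).toNat, (v j).toNat, ?_⟩, ?_⟩
  · conv_lhs => rw [eq_smul_add_smul hij hv]
    rw [← natCast_zsmul, ← natCast_zsmul, Int.toNat_of_nonneg (h0 i), Int.toNat_of_nonneg (h0 j)]
  · rintro ⟨p, q, rfl⟩
    refine ⟨add_nonneg (nsmul_nonneg (single_pos i).le p) (nsmul_nonneg (single_pos j).le q),
      fun k hk => ?_⟩
    simp only [Set.mem_insert_iff, Set.mem_singleton_iff, not_or] at hk
    simp [hk.1, hk.2]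

theorem altProd_ρ_comm (hij : i ≠ j) (hfin : (R.posPair i j y).Finite) :
    altProd (R.ρ i) (R.ρ j) (R.posPair i j y).ncard y =
      altProd (R.ρ j) (R.ρ i) (R.posPair i j y).ncard y := by
  rw [posPair_eq hij] at hfin ⊢
  have h := R.root_coxeter y i j hij hfin
  rw [← altProd_inv_mul (R.ρ_invol j) (R.ρ_invol i), Equiv.Perm.mul_apply,
    Equiv.Perm.inv_eq_iff_eq] at h
  exact h.symm

theorem Mor.det_pair (hij : i ≠ j) (hg : R.Mor {i, j} n x g y) :
    g (Pi.single i 1) i * g (Pi.single j 1) j - g (Pi.single i 1) j * g (Pi.single j 1) i =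
      (-1) ^ n := by
  induction hg with
  | nil => simp [hij]
  | @snoc n x y g l hl _ ih =>
    rcases hl with rfl | rfl
    · simp only [LinearEquiv.mul_apply, simpleRefl_single_self, R.simpleRefl_single y l j, map_sub,
        map_neg, map_smul, Pi.sub_apply, Pi.neg_apply, Pi.smul_apply, smul_eq_mul, pow_succ, ← ih]
      ring
    · simp only [LinearEquiv.mul_apply, simpleRefl_single_self, R.simpleRefl_single y l i, map_sub,
        map_neg, map_smul, Pi.sub_apply, Pi.neg_apply, Pi.smul_apply, smul_eq_mul, pow_succ, ← ih]
      ring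

theorem single_support {l : Fin θ} {J : Set (Fin θ)} (hl : l ∈ J) {k : Fin θ} (hk : k ∉ J) :
    (Pi.single l 1 : Fin θ → ℤ) k = 0 := by
  have : k ≠ l := by rintro rfl; exact hk hl
  simp [this]

/-- A product of an even number of reflections at `i` and `j` which keeps `α_i` and `α_j` positive,
as does its inverse, is trivial. -/
theorem Mor.eq_one_of_pair (hij : i ≠ j) (hn : Even n) (hg : R.Mor {i, j} n x g y)
    (hi : 0 ≤ g (Pi.single i 1)) (hj : 0 ≤ g (Pi.single j 1))
    (hi' : 0 ≤ g⁻¹ (Pi.single i 1)) (hj' : 0 ≤ g⁻¹ (Pi.single j 1)) : g = 1 := by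
  have hgg (v) : g (g⁻¹ v) = v := by rw [← LinearEquiv.mul_apply, mul_inv_cancel]; rfl
  have hgg' (v) : g⁻¹ (g v) = v := by rw [← LinearEquiv.mul_apply, inv_mul_cancel]; rfl
  have supp {l} (hl : l ∈ ({i, j} : Set (Fin θ))) (k) (hk : k ∉ ({i, j} : Set (Fin θ))) :
      g (Pi.single l 1) k = 0 := by
    rw [hg.apply_of_notMem hk, single_support hl hk]
  have supp' {l} (hl : l ∈ ({i, j} : Set (Fin θ))) (k) (hk : k ∉ ({i, j} : Set (Fin θ))) :
      g⁻¹ (Pi.single l 1) k = 0 := by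
    rw [hg.symm.apply_of_notMem hk, single_support hl hk]
  have hdet := hg.det_pair hij
  rw [hn.neg_one_pow] at hdet
  have eqi := hgg (Pi.single i 1)
  have eqj := hgg (Pi.single j 1)
  rw [eq_smul_add_smul hij (supp' (by simp)), map_add, map_smul, map_smul] at eqi eqj
  have e1 := congr_fun eqi i
  have e2 := congr_fun eqi j
  have e3 := congr_fun eqj i
  have e4 := congr_fun eqj j
  simp only [Pi.add_apply, Pi.smul_apply, smul_eq_mul, Pi.single_eq_same,
    Pi.single_eq_of_ne hij, Pi.single_eq_of_ne hij.symm] at e1 e2 e3 e4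
  have a1 := hi i
  have a2 := hi j
  have a3 := hj i
  have a4 := hj j
  have b1 := hi' i
  have b2 := hi' j
  have b3 := hj' i
  have b4 := hj' j
  simp only [Pi.zero_apply] at a1 a2 a3 a4 b1 b2 b3 b4
  have key : g (Pi.single i 1) i = 1 ∧ g (Pi.single i 1) j = 0 ∧ g (Pi.single j 1) i = 0 ∧
      g (Pi.single j 1) j = 1 := by
    generalize g (Pi.single i 1) i = p at *
    generalize g (Pi.single i 1) j = q at *
    generalize g (Pi.single j 1) i = r at *
    generalize g (Pi.single j 1) j = s at *
    generalize g⁻¹ (Pi.single i 1) i = p' at *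
    generalize g⁻¹ (Pi.single i 1) j = q' at *
    generalize g⁻¹ (Pi.single j 1) i = r' at *
    generalize g⁻¹ (Pi.single j 1) j = s' at *
    have hps : 0 < p * s := by nlinarith [mul_nonneg a2 a3]
    have hp : 0 < p := pos_of_mul_pos_left hps a4
    have hs : 0 < s := pos_of_mul_pos_right hps a1
    have hq' : q' = 0 := by nlinarith [mul_nonneg b1 a2, mul_nonneg b2 a4]
    have hr' : r' = 0 := by nlinarith [mul_nonneg b3 a1, mul_nonneg b4 a3]
    subst hq' hr'
    simp only [zero_mul, add_zero, zero_add] at e1 e2 e3 e4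
    have hp1 : p = 1 := Int.eq_one_of_mul_eq_one_left a1 e1
    have hs1 : s = 1 := Int.eq_one_of_mul_eq_one_left a4 e4
    have hp1' : p' = 1 := by simpa [hp1] using e1
    have hs1' : s' = 1 := by simpa [hs1] using e4
    refine ⟨hp1, by simpa [hp1'] using e2, by simpa [hs1'] using e3, hs1⟩
  have gi : g (Pi.single i 1) = Pi.single i 1 := by
    rw [eq_smul_add_smul hij (supp (l := i) (by simp)), key.1, key.2.1]
    simp
  have gj : g (Pi.single j 1) = Pi.single j 1 := by
    rw [eq_smul_add_smul hij (supp (l := j) (by simp)), key.2.2.1, key.2.2.2]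
    simp
  suffices h : (g : (Fin θ → ℤ) →ₗ[ℤ] (Fin θ → ℤ)) = LinearMap.id from
    LinearEquiv.ext fun v => LinearMap.congr_fun h v
  refine LinearMap.pi_ext' fun k => LinearMap.ext_ring ?_
  change g (Pi.single k 1) = Pi.single k 1
  by_cases hk : k ∈ ({i, j} : Set (Fin θ))
  · rcases hk with rfl | rfl <;> assumption
  set u := g (Pi.single k 1) - Pi.single k 1 with hu
  have hgk : g (Pi.single k 1) = Pi.single k 1 + u := by rw [hu]; abel
  have husupp : ∀ l, l ∉ ({i, j} : Set (Fin θ)) → u l = 0 := fun l hl => by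
    rw [hu, Pi.sub_apply, hg.apply_of_notMem hl, sub_self]
  have hgu : g u = u := by
    rw [eq_smul_add_smul hij husupp, map_add, map_smul, map_smul, gi, gj]
  have hgk' : g⁻¹ (Pi.single k 1) = Pi.single k 1 - u := by
    apply g.injective
    rw [hgg, map_sub, hgk, hgu, add_sub_cancel_right]
  have pos1 : 0 ≤ Pi.single k 1 + u := by
    rw [← hgk]
    refine (nonneg_or_nonpos (hg.map_mem (R.single_mem y k))).resolve_right fun h => ?_
    have := h k
    rw [hg.apply_of_notMem hk] at this
    simp at this
  have pos2 : 0 ≤ Pi.single k 1 - u := by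
    rw [← hgk']
    refine (nonneg_or_nonpos (hg.symm.map_mem (R.single_mem x k))).resolve_right fun h => ?_
    have := h k
    rw [hg.symm.apply_of_notMem hk] at this
    simp at this
  have hu0 : u = 0 := by
    ext l
    by_cases hl : l ∈ ({i, j} : Set (Fin θ))
    · have hlk : l ≠ k := by rintro rfl; exact hk hl
      have h1 := pos1 l
      have h2 := pos2 l
      simp only [Pi.add_apply, Pi.sub_apply, Pi.single_eq_of_ne hlk, Pi.zero_apply] at h1 h2 ⊢
      linarith
    · exact husupp l hl
  rw [hgk, hu0, add_zero]

theorem Mor.inv_map_nonpos (hij : i ≠ j) (hg : R.Mor {i, j} n x g y)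
    (hi : g (Pi.single i 1) ≤ 0) (hj : g (Pi.single j 1) ≤ 0) (hv : v ∈ R.posPair i j x) :
    g⁻¹ v ≤ 0 := by
  refine (nonneg_or_nonpos (hg.symm.map_mem hv.1)).resolve_left fun h => ?_
  have := map_nonpos_of_support hij hi hj
    (fun k hk => by rw [hg.symm.apply_of_notMem hk, hv.2.2 k hk]) h
  rw [← LinearEquiv.mul_apply, mul_inv_cancel] at this
  exact not_nonneg_of_nonpos i hv.1 this hv.2.1

theorem Mor.neg_map_mem_posPair (hg : R.Mor {i, j} n x g y)
    (hv : v ∈ R.inversions {i, j} g y) : -g v ∈ R.posPair i j x :=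
  ⟨neg_mem (hg.map_mem hv.1), neg_nonneg.2 hv.2.2.2, fun k hk => by
    rw [Pi.neg_apply, hg.apply_of_notMem hk, hv.2.2.1 k hk, neg_zero]⟩

theorem Mor.neg_map_injective (g : (Fin θ → ℤ) ≃ₗ[ℤ] (Fin θ → ℤ)) :
    Injective fun v => -g v := fun _ _ h => g.injective (neg_injective h)

theorem Mor.ncard_inversions_eq (hij : i ≠ j) (hg : R.Mor {i, j} n x g y)
    (hi : g (Pi.single i 1) ≤ 0) (hj : g (Pi.single j 1) ≤ 0) :
    (R.inversions {i, j} g y).ncard = (R.posPair i j x).ncard := by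
  have : (fun v => -g v) '' R.inversions {i, j} g y = R.posPair i j x := by
    refine Set.Subset.antisymm (Set.image_subset_iff.2 fun v hv => hg.neg_map_mem_posPair hv) ?_
    intro v hv
    have hgg : g (g⁻¹ v) = v := by rw [← LinearEquiv.mul_apply, mul_inv_cancel]; rfl
    refine ⟨-g⁻¹ v, ⟨neg_mem (hg.symm.map_mem hv.1),
      neg_nonneg.2 (hg.inv_map_nonpos hij hi hj hv), fun k hk => ?_, ?_⟩, by simp⟩
    · rw [Pi.neg_apply, hg.symm.apply_of_notMem hk, hv.2.2 k hk, neg_zero]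
    · rw [map_neg, hgg]
      exact neg_nonpos.2 hv.2.1
  rw [← this, Set.ncard_image_of_injective _ (neg_map_injective g)]

variable (R) in
/-- The element `u` of the rank two groupoid at `i`, `j` is an alternating product of `n` generators
starting with `ς_i`; all of them are descents when appended to some `g` having `g α_i`, `g α_j`
negative. -/
structure AltPath (i j : Fin θ) (y : X) (n : ℕ) (u : (Fin θ → ℤ) ≃ₗ[ℤ] (Fin θ → ℤ)) : Prop where
  mor : R.Mor {i, j} n y u (altProd (R.ρ i) (R.ρ j) n y)
  ncard_inversions : (R.inversions {i, j} u (altProd (R.ρ i) (R.ρ j) n y)).ncard = n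
  descent : ∀ g : (Fin θ → ℤ) ≃ₗ[ℤ] (Fin θ → ℤ), g (Pi.single i 1) ≤ 0 → g (Pi.single j 1) ≤ 0 →
    Relation.ReflTransGen R.Descent (R.ρ i y, g * R.simpleRefl y i)
      (altProd (R.ρ i) (R.ρ j) n y, g * u)

theorem AltPath.one (i j : Fin θ) (y : X) : R.AltPath i j y 1 (R.simpleRefl y i) where
  mor := Mor.single (by simp)
  ncard_inversions := by
    have := (Mor.nil (R := R) (J := Set.univ) y).ncard_inversions_snoc (J := {i, j}) (i := i)
      (by simp) (single_pos i).le
    rw [one_mul] at this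
    refine this.trans ?_
    convert zero_add 1
    rw [Set.ncard_eq_zero (Mor.nil (R := R) y).finite_inversions']
    refine Set.eq_empty_of_forall_notMem ?_
    rintro v ⟨hv, hv0, -, hv'⟩
    exact not_nonneg_of_nonpos i hv hv' hv0
  descent g _ _ := .refl

theorem AltPath.succ (hij : i ≠ j) {u : (Fin θ → ℤ) ≃ₗ[ℤ] (Fin θ → ℤ)} (hu : R.AltPath i j y n u)
    {l : Fin θ} (hl : l = if Even n then i else j) (h0 : 0 ≤ u (Pi.single l 1)) :
    R.AltPath i j y (n + 1)
      (u * R.simpleRefl (altProd (R.ρ i) (R.ρ j) n y) l) := by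
  have hl' : l ∈ ({i, j} : Set (Fin θ)) := by subst hl; split_ifs <;> simp
  have he : altProd (R.ρ i) (R.ρ j) (n + 1) y = R.ρ l (altProd (R.ρ i) (R.ρ j) n y) := by
    rw [altProd_succ_left, hl, Equiv.Perm.mul_apply]
    split_ifs <;> rfl
  refine ⟨?_, ?_, fun g hi hj => ?_⟩ <;> rw [he]
  · exact hu.mor.snoc hl'
  · rw [(hu.mor.mono (Set.subset_univ _)).ncard_inversions_snoc hl' h0, hu.ncard_inversions]
  · refine (hu.descent g hi hj).tail ?_
    rw [← mul_assoc]
    refine .mk _ _ _ (map_nonpos_of_support (g := g) hij hi hj (fun k hk => ?_) h0)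
    exact (hu.mor.apply_of_notMem hk _).trans (single_support hl' hk)

theorem exists_altPath_aux (hij : i ≠ j) (y : X) (n : ℕ) :
    (∃ k u, R.AltPath i j y k u ∧ u (Pi.single i 1) ≤ 0 ∧ u (Pi.single j 1) ≤ 0) ∨
      ∃ u, R.AltPath i j y (n + 1) u ∧ 0 ≤ u (Pi.single (if Even n then j else i) 1) ∧
        u (Pi.single (if Even n then i else j) 1) ≤ 0 := by
  have dich {k u l} (h : R.AltPath i j y k u) :
      0 ≤ u (Pi.single l 1) ∨ u (Pi.single l 1) ≤ 0 :=
    nonneg_or_nonpos (h.mor.map_mem (R.single_mem _ l))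
  induction n with
  | zero =>
    have h1 : R.simpleRefl y i (Pi.single i 1) ≤ 0 := by
      rw [simpleRefl_single_self]
      exact neg_nonpos.2 (single_pos i).le
    rcases dich (l := j) (AltPath.one i j y) with h | h
    · exact Or.inr ⟨_, AltPath.one i j y, by simpa using h, by simpa using h1⟩
    · exact Or.inl ⟨_, _, AltPath.one i j y, h1, h⟩
  | succ n ih =>
    rcases ih with ih | ⟨u, hu, h0, -⟩
    · exact Or.inl ih
    obtain ⟨l, hl⟩ : ∃ l, l = if Even n then j else i := ⟨_, rfl⟩
    have hl₁ : l = if Even (n + 1) then i else j := by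
      rw [hl]; by_cases h : Even n <;> simp [h, Nat.even_add_one]
    rw [← hl] at h0
    have hu' := hu.succ hij hl₁ h0
    have hneg : (u * R.simpleRefl (altProd (R.ρ i) (R.ρ j) (n + 1) y) l) (Pi.single l 1) ≤ 0 := by
      rw [mul_simpleRefl_single]
      exact neg_nonpos.2 h0
    rcases dich (l := if Even (n + 1) then j else i) hu' with h | h
    · exact Or.inr ⟨_, hu', h, hl₁ ▸ hneg⟩
    · refine Or.inl ⟨_, _, hu', ?_⟩
      rw [hl₁] at hneg h ⊢
      by_cases hn : Even (n + 1)
      · simp only [hn, if_true] at hneg h ⊢; exact ⟨hneg, h⟩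
      · simp only [hn, if_false] at hneg h ⊢; exact ⟨h, hneg⟩

/-- If there are finitely many positive roots in the span of `α_i` and `α_j`, then the rank two
groupoid has a longest element at `y`, obtained by alternating reflections. -/
theorem exists_altPath (hij : i ≠ j) (hfin : (R.posPair i j y).Finite) :
    ∃ u, R.AltPath i j y (R.posPair i j y).ncard u ∧
      u (Pi.single i 1) ≤ 0 ∧ u (Pi.single j 1) ≤ 0 := by
  rcases exists_altPath_aux (R := R) hij y (R.posPair i j y).ncard with
    ⟨k, u, hu, hi, hj⟩ | ⟨u, hu, -⟩
  · have := hu.mor.ncard_inversions_eq hij hi hj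
    rw [hu.ncard_inversions] at this
    subst this
    exact ⟨u, hu, hi, hj⟩
  · have := Set.ncard_le_ncard_of_injOn _ (fun v hv => hu.mor.neg_map_mem_posPair hv)
      (Mor.neg_map_injective u).injOn hfin
    rw [hu.ncard_inversions] at this
    omega

theorem Mor.descent_join (hg : R.Mor Set.univ n x g y) (hi : g (Pi.single i 1) ≤ 0)
    (hj : g (Pi.single j 1) ≤ 0) :
    Relation.Join (Relation.ReflTransGen R.Descent) (R.ρ i y, g * R.simpleRefl y i)
      (R.ρ j y, g * R.simpleRefl y j) := by
  rcases eq_or_ne i j with rfl | hij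
  · exact ⟨_, .refl, .refl⟩
  have hfin : (R.posPair i j y).Finite := hg.finite_inversions'.subset fun v hv =>
    ⟨hv.1, hv.2.1, hv.2.2, map_nonpos_of_support hij hi hj hv.2.2 hv.2.1⟩
  have hcomm : R.posPair j i y = R.posPair i j y := by
    simp only [posPair, Set.pair_comm]
  obtain ⟨u, hu, ui, uj⟩ := exists_altPath hij hfin
  obtain ⟨u', hu', uj', ui'⟩ := exists_altPath hij.symm (hcomm ▸ hfin)
  rw [hcomm] at hu'
  have hend := altProd_ρ_comm hij hfin
  have hmor : R.Mor {i, j} _ y u' _ := Set.pair_comm j i ▸ hu'.mor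
  have key {w w' : (Fin θ → ℤ) ≃ₗ[ℤ] (Fin θ → ℤ)} {m m' z z'} (hw : R.Mor {i, j} m y w z)
      (hw' : R.Mor {i, j} m' y w' z') (wi' : w' (Pi.single i 1) ≤ 0)
      (wj' : w' (Pi.single j 1) ≤ 0) {l} (hl : l ∈ ({i, j} : Set (Fin θ)))
      (wl : w (Pi.single l 1) ≤ 0) : 0 ≤ (w'⁻¹ * w) (Pi.single l 1) := by
    have := hw'.inv_map_nonpos hij wi' wj' (hw.neg_map_mem_posPair
      ⟨R.single_mem _ l, (single_pos l).le, fun k hk => single_support hl hk, wl⟩)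
    rw [map_neg] at this
    exact neg_nonpos.1 this
  have hone : u'⁻¹ * u = 1 := by
    refine (hmor.symm.trans hu.mor).eq_one_of_pair hij ⟨_, rfl⟩ ?_ ?_ ?_ ?_
    · exact key hu.mor hmor ui' uj' (by simp) ui
    · exact key hu.mor hmor ui' uj' (by simp) uj
    · rw [mul_inv_rev, inv_inv]
      exact key hmor hu.mor ui uj (by simp) ui'
    · rw [mul_inv_rev, inv_inv]
      exact key hmor hu.mor ui uj (by simp) uj'
  rw [inv_mul_eq_one] at hone
  refine ⟨_, hu.descent g hi hj, ?_⟩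
  rw [hend, ← hone]
  exact hu'.descent g hj hi

end RankTwo

section NormalForm

variable {R} {n : ℕ} {x y : X} {g : (Fin θ → ℤ) ≃ₗ[ℤ] (Fin θ → ℤ)}

open Relation

theorem descent_iff {q} : R.Descent (y, g) q ↔
    ∃ i, g (Pi.single i 1) ≤ 0 ∧ q = (R.ρ i y, g * R.simpleRefl y i) := by
  constructor
  · rintro ⟨_, _, i, hi⟩
    exact ⟨i, hi, rfl⟩
  · rintro ⟨i, hi, rfl⟩
    exact .mk y g i hi

theorem Mor.of_descents (hg : R.Mor Set.univ n x g y) {q} (h : ReflTransGen R.Descent (y, g) q) :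
    ∃ k, R.Mor Set.univ k x q.2 q.1 := by
  induction h with
  | refl => exact ⟨n, hg⟩
  | tail _ hq ih =>
    obtain ⟨z, h, i, -⟩ := hq
    obtain ⟨k, hk⟩ := ih
    exact ⟨k + 1, hk.snoc (Set.mem_univ i)⟩

theorem Mor.exists_normalForm (hg : R.Mor Set.univ n x g y) :
    ∃ q, ReflTransGen R.Descent (y, g) q ∧ ∀ q', ¬R.Descent q q' := by
  induction hN : (R.inversions Set.univ g y).ncard generalizing n y g with
  | zero =>
    refine ⟨_, .refl, ?_⟩
    intro q' hq'
    obtain ⟨i, hi, -⟩ := descent_iff.1 hq'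
    rw [hg.ncard_inversions_of_nonpos (Set.mem_univ i) hi] at hN
    omega
  | succ N ih =>
    by_cases hd : ∃ i : Fin θ, g (Pi.single i 1) ≤ 0
    · obtain ⟨i, hi⟩ := hd
      rw [hg.ncard_inversions_of_nonpos (Set.mem_univ i) hi, Nat.add_right_cancel_iff] at hN
      obtain ⟨q, hq, hqn⟩ := ih (hg.snoc (Set.mem_univ i)) hN
      exact ⟨q, .head (.mk y g i hi) hq, hqn⟩
    · refine ⟨_, .refl, ?_⟩
      intro q' hq'
      obtain ⟨i, hi, -⟩ := descent_iff.1 hq'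
      exact hd ⟨i, hi⟩

/-- Descending chains that start at the same element of the Weyl groupoid end in the same element
without descents. -/
theorem Mor.normalForm_unique (hg : R.Mor Set.univ n x g y) {q q'}
    (hq : ReflTransGen R.Descent (y, g) q) (hqn : ∀ p, ¬R.Descent q p)
    (hq' : ReflTransGen R.Descent (y, g) q') (hqn' : ∀ p, ¬R.Descent q' p) : q = q' := by
  induction hN : (R.inversions Set.univ g y).ncard generalizing n y g q q' with
  | zero =>
    have hn : ∀ p, ¬R.Descent (y, g) p := by
      intro p hp
      obtain ⟨i, hi, -⟩ := descent_iff.1 hp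
      rw [hg.ncard_inversions_of_nonpos (Set.mem_univ i) hi] at hN
      omega
    rcases hq.cases_head with rfl | ⟨p, hp, -⟩
    · rcases hq'.cases_head with rfl | ⟨p, hp, -⟩
      · rfl
      · exact (hn p hp).elim
    · exact (hn p hp).elim
  | succ N ih =>
    rcases hq.cases_head with rfl | ⟨p, hp, hpq⟩
    · rcases hq'.cases_head with rfl | ⟨p, hp, -⟩
      · rfl
      · exact (hqn p hp).elim
    rcases hq'.cases_head with rfl | ⟨p', hp', hpq'⟩
    · exact (hqn' p hp).elim
    obtain ⟨i, hi, rfl⟩ := descent_iff.1 hp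
    obtain ⟨j, hj, rfl⟩ := descent_iff.1 hp'
    have hNi := hg.ncard_inversions_of_nonpos (Set.mem_univ i) hi
    have hNj := hg.ncard_inversions_of_nonpos (Set.mem_univ j) hj
    obtain ⟨r, hir, hjr⟩ := hg.descent_join hi hj
    have hgi := hg.snoc (Set.mem_univ i)
    obtain ⟨k, hk⟩ := hgi.of_descents hir
    obtain ⟨t, ht, htn⟩ := hk.exists_normalForm
    exact (ih hgi hpq hqn (hir.trans ht) htn (by omega)).trans
      (ih (hg.snoc (Set.mem_univ j)) (hjr.trans ht) htn hpq' hqn' (by omega))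

theorem not_descent_one (y : X) (q) : ¬R.Descent (y, 1) q := by
  intro hq
  obtain ⟨i, hi, -⟩ := descent_iff.1 hq
  exact (single_pos i).not_ge hi

theorem Mor.descents_one (hg : R.Mor Set.univ n x g y) :
    ReflTransGen R.Descent (y, g) (x, 1) := by
  induction hg with
  | nil => exact .refl
  | @snoc n x y g i hi hg ih =>
    rcases hg.map_single_nonneg_or_nonpos i with h | h
    · refine .head (.mk _ _ i ?_) ?_
      · rw [mul_simpleRefl_single]
        exact neg_nonpos.2 h
      · rwa [mul_simpleRefl_mul_simpleRefl, ρ_ρ]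
    · obtain ⟨q, hq, hqn⟩ := (hg.snoc hi).exists_normalForm
      rwa [← hg.normalForm_unique (.head (.mk y g i h) hq) hqn ih (not_descent_one x)]

/-- An element of the Weyl groupoid is determined by its underlying linear map and one of its two
end points. -/
theorem Mor.target_unique {m : ℕ} {z : X} (hg : R.Mor Set.univ m x g y)
    (hg' : R.Mor Set.univ n x g z) : y = z := by
  have h := (hg.symm.trans hg').descents_one
  rw [inv_mul_cancel] at h
  rcases h.cases_head with h | ⟨p, hp, -⟩
  · exact (congr_arg Prod.fst h).symm
  · exact (not_descent_one z p hp).elim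

end NormalForm

section Weyl

variable {R} {n : ℕ} {x y : X} {g : (Fin θ → ℤ) → (Fin θ → ℤ)}

theorem Weyl.exists_mor (hg : R.Weyl x g y) :
    ∃ n, ∃ e : (Fin θ → ℤ) ≃ₗ[ℤ] (Fin θ → ℤ), ⇑e = g ∧ R.Mor Set.univ n x e y := by
  induction hg with
  | nil x => exact ⟨0, 1, rfl, .nil x⟩
  | cons x i _ ih =>
    obtain ⟨n, e, rfl, he⟩ := ih
    exact ⟨_, R.simpleRefl x i * e, rfl, (Mor.single (Set.mem_univ i)).trans he⟩

theorem Weyl.snoc (hg : R.Weyl x g y) (i : Fin θ) :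
    R.Weyl x (g ∘ cartanRefl (R.C y) i) (R.ρ i y) := by
  induction hg with
  | nil x => exact .cons x i (.nil _)
  | cons x j _ ih => exact .cons x j ih

variable (R) in
theorem exists_weyl (x y : X) : ∃ g, R.Weyl x g y := by
  induction R.connected x y with
  | refl => exact ⟨_, .nil x⟩
  | tail _ h ih =>
    obtain ⟨i, rfl⟩ := h
    obtain ⟨g, hg⟩ := ih
    exact ⟨_, hg.snoc i⟩

theorem realRoots_subset (x : X) : R.realRoots x ⊆ R.Δ x := by
  rintro _ ⟨i, g, y, hg, rfl⟩
  obtain ⟨n, e, rfl, he⟩ := hg.exists_mor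
  exact he.map_mem (R.single_mem y i)

theorem finite_roots_of_finite_pos
    (h : {v ∈ R.Δ x | 0 ≤ v}.Finite) : (R.Δ x).Finite := by
  rw [R.root_pos_neg]
  exact h.union (h.image _)

theorem finite_roots_of_exists (hx : (R.Δ x).Finite) (y : X) : (R.Δ y).Finite := by
  induction R.connected x y with
  | refl => exact hx
  | tail _ h ih =>
    obtain ⟨i, rfl⟩ := h
    rw [← R.root_refl]
    exact ih.image _

/-- In a finite Weyl groupoid, an element with the most inversions inverts all positive roots. -/
theorem FiniteWeyl.exists_finite_roots (hR : R.FiniteWeyl) : ∃ x : X, (R.Δ x).Finite := by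
  obtain ⟨x⟩ := R.nonempty
  obtain ⟨⟨x, g, y⟩, hg, hmax⟩ := Set.exists_max_image _
    (fun p : X × ((Fin θ → ℤ) → (Fin θ → ℤ)) × X => (R.inversions Set.univ p.2.1 p.2.2).ncard)
    hR ⟨(x, _root_.id, x), .nil x⟩
  obtain ⟨n, e, rfl, he⟩ := Weyl.exists_mor hg
  have hneg (i : Fin θ) : e (Pi.single i 1) ≤ 0 := by
    refine (he.map_single_nonneg_or_nonpos i).resolve_left fun h => ?_
    have h1 := he.ncard_inversions_snoc (Set.mem_univ i) h
    have h2 := hmax (x, _, R.ρ i y) (Weyl.snoc hg i)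
    change (R.inversions Set.univ
      (e * R.simpleRefl y i : (Fin θ → ℤ) ≃ₗ[ℤ] (Fin θ → ℤ)) (R.ρ i y)).ncard ≤ _ at h2
    exact absurd (h1 ▸ h2) (Nat.not_succ_le_self _)
  refine ⟨y, finite_roots_of_finite_pos (he.finite_inversions.subset fun v ⟨hv, hv0⟩ =>
    ⟨hv, hv0, fun k hk => (hk trivial).elim, ?_⟩)⟩
  rw [pi_eq_sum_univ' v, map_sum]
  refine Finset.sum_nonpos fun i _ => ?_
  rw [map_smul]
  refine smul_nonpos_of_nonneg_of_nonpos (hv0 i) ?_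
  convert hneg i using 2

theorem finite_weyl_at (h : (R.realRoots x).Finite) :
    {p : ((Fin θ → ℤ) → (Fin θ → ℤ)) × X | R.Weyl x p.1 p.2}.Finite := by
  refine Set.Finite.of_injOn (f := fun p i => p.1 (Pi.single i 1)) ?_ ?_
    (Set.Finite.pi' fun _ : Fin θ => h)
  · rintro ⟨g, y⟩ hg i
    exact ⟨i, g, y, hg, rfl⟩
  · rintro ⟨g, y⟩ hg ⟨g', y'⟩ hg' heq
    obtain ⟨n, e, rfl, he⟩ := Weyl.exists_mor hg
    obtain ⟨n', e', rfl, he'⟩ := Weyl.exists_mor hg'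
    have : e = e' := by
      refine LinearEquiv.toLinearMap_injective (LinearMap.pi_ext' fun k => LinearMap.ext_ring ?_)
      exact congr_fun heq k
    subst this
    exact congr_arg (Prod.mk ⇑e) (he.target_unique he')

theorem finiteWeyl_of_realRoots (h : ∀ x, (R.realRoots x).Finite) : R.FiniteWeyl := by
  obtain ⟨x₀⟩ := R.nonempty
  have : Finite X := by
    refine Set.finite_univ_iff.1 (((finite_weyl_at (h x₀)).image Prod.snd).subset fun y _ => ?_)
    obtain ⟨g, hg⟩ := R.exists_weyl x₀ y
    exact ⟨(g, y), hg, rfl⟩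
  refine (Set.finite_iUnion fun x => (finite_weyl_at (h x)).image (Prod.mk x)).subset ?_
  rintro ⟨x, p⟩ hp
  exact Set.mem_iUnion.2 ⟨x, p, hp, rfl⟩

end Weyl

end GRS

/-- For a generalized root system `R` over a connected basic datum, the following
are equivalent: (a) `R` is finite (its Weyl groupoid is a finite set); (b) `Δ^x` is finite for
all `x`; (c) `Δ^x` is finite for some `x`; (d) the set of real roots at `x` is finite for
all `x`. -/
theorem stmt1 {θ : ℕ} {X : Type*} (R : GRS θ X) :
    [R.FiniteWeyl,
     ∀ x : X, (R.Δ x).Finite,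
     ∃ x : X, (R.Δ x).Finite,
     ∀ x : X, (R.realRoots x).Finite].TFAE := by
  tfae_have 1 → 3 := GRS.FiniteWeyl.exists_finite_roots
  tfae_have 3 → 2 := fun ⟨_, hx⟩ => GRS.finite_roots_of_exists hx
  tfae_have 2 → 4 := fun h x => (h x).subset (GRS.realRoots_subset x)
  tfae_have 4 → 1 := GRS.finiteWeyl_of_realRoots
  tfae_finish
end

section
/- Let q = (q_{ij})_{i,j∈I} be a braiding matrix of Cartan type, i.e. there are integers a_{ij} with a_{ii} = 2 for all i and q_{ij}q_{ji} = q_{ii}^{a_{ij}} for all i ≠ j. Fix i ∈ I and define the reflected matrix ρ_i(q) by ρ_i(q)_{jk} := q_{jk} · q_{ik}^{−a_{ij}} · q_{ji}^{−a_{ik}} · q_{ii}^{a_{ij} a_{ik}} for all j, k ∈ I. Then ρ_i(q) is twist-equivalent to q; that is, ρ_i(q)_{jj} = q_{jj} for all j ∈ I, and ρ_i(q)_{jk} · ρ_i(q)_{kj} = q_{jk} q_{kj} for all j ≠ k in I. -/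
theorem mul_zpow_neg_mul_zpow_neg_mul_zpow {K : Type*} [Field K] {x y t : K} (ht : t ≠ 0)
    {m : ℤ} (h : x * y = t ^ m) (n : ℤ) : x ^ (-n) * y ^ (-n) * t ^ (n * m) = 1 := by
  rw [← mul_zpow, h, ← zpow_mul, ← zpow_add₀ ht]
  simp [mul_comm]

/-- Let `q` be a braiding matrix of Cartan type, with integers `a i j`
(`a i i = 2`, `q i j * q j i = q i i ^ a i j` for `i ≠ j`). For fixed `i`, the reflected
matrix `ρ_i(q)` with entries `ρ_i(q)_{jk} = q_{jk} q_{ik}^{-a_{ij}} q_{ji}^{-a_{ik}}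
q_{ii}^{a_{ij} a_{ik}}` is twist-equivalent to `q`: it has the same diagonal entries and the
same products `q_{jk} q_{kj}` for `j ≠ k`. -/
theorem stmt11 {θ : ℕ} {𝕜 : Type*} [Field 𝕜] (q : Fin θ → Fin θ → 𝕜)
    (hq : ∀ i j, q i j ≠ 0) (a : Fin θ → Fin θ → ℤ) (ha : ∀ i, a i i = 2)
    (hCartan : ∀ i j, i ≠ j → q i j * q j i = q i i ^ a i j) (i : Fin θ) :
    letI r : Fin θ → Fin θ → 𝕜 := fun j k =>
      q j k * q i k ^ (-(a i j)) * q j i ^ (-(a i k)) * q i i ^ (a i j * a i k)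
    (∀ j, r j j = q j j) ∧ (∀ j k, j ≠ k → r j k * r k j = q j k * q k j) := by
  have hC : ∀ j, q i j * q j i = q i i ^ a i j := by
    intro j
    rcases eq_or_ne i j with rfl | h
    · rw [ha, zpow_two]
    · exact hCartan i j h
  refine ⟨fun j => ?_, fun j k _ => ?_⟩
  · have h := mul_zpow_neg_mul_zpow_neg_mul_zpow (hq i i) (hC j) (a i j)
    linear_combination q j j * h
  · have h₁ := mul_zpow_neg_mul_zpow_neg_mul_zpow (hq i i) (hC k) (a i j)
    have h₂ := mul_zpow_neg_mul_zpow_neg_mul_zpow (hq i i) (hC j) (a i k)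
    rw [mul_comm (a i k)] at h₂
    simp only [mul_comm (a i k) (a i j)]
    generalize q i i ^ (a i j * a i k) = u at *
    generalize q i k ^ (-(a i j)) = v at *
    generalize q k i ^ (-(a i j)) = w at *
    generalize q i j ^ (-(a i k)) = x at *
    generalize q j i ^ (-(a i k)) = y at *
    linear_combination q j k * q k j * (x * y * u * h₁ + h₂)
end

section
/- Let q = (q_{ij})_{i,j∈I} be an admissible braiding matrix, with Cartan matrix c^q and reflections s_i^q defined as below, and fix i ∈ I. Suppose the reflected matrix ρ_i(q) is again admissible and that c^{ρ_i(q)}_{ij} = c^q_{ij} for all j ∈ I. Then ρ_i(ρ_i(q)) = q, i.e. ρ_i is an involution. -/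
/-- The set `N_{ij} = {n ∈ ℕ₀ : (n+1)_{q_{ii}} (1 - q_{ii}^n q_{ij} q_{ji}) = 0}`. -/
def qSet {θ : ℕ} {𝕜 : Type*} [Field 𝕜] (q : Fin θ → Fin θ → 𝕜) (i j : Fin θ) : Set ℕ :=
  {n : ℕ | (∑ m ∈ Finset.range (n + 1), q i i ^ m) * (1 - q i i ^ n * q i j * q j i) = 0}

/-- A braiding matrix `q` is admissible if the sets `N_{ij}` are nonempty for all `i ≠ j`. -/
def qAdmissible {θ : ℕ} {𝕜 : Type*} [Field 𝕜] (q : Fin θ → Fin θ → 𝕜) : Prop :=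
  ∀ i j : Fin θ, i ≠ j → (qSet q i j).Nonempty

/-- The generalized Cartan matrix `c^q` of an admissible braiding matrix:
`c^q_{ii} = 2` and `c^q_{ij} = -min N_{ij}` for `i ≠ j`. -/
noncomputable def qCartan {θ : ℕ} {𝕜 : Type*} [Field 𝕜] (q : Fin θ → Fin θ → 𝕜)
    (i j : Fin θ) : ℤ :=
  if i = j then 2 else -((sInf (qSet q i j) : ℕ) : ℤ)

/-- The reflection `s_i^q ∈ GL(ℤ^θ)`, `s_i^q(α_j) = α_j - c^q_{ij} α_i`. -/
noncomputable def qRefl {θ : ℕ} {𝕜 : Type*} [Field 𝕜] (q : Fin θ → Fin θ → 𝕜) (i : Fin θ) :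
    (Fin θ → ℤ) → (Fin θ → ℤ) :=
  fun v => v - (∑ j, qCartan q i j * v j) • Pi.single i 1

/-- The ℤ-bilinear extension `q : ℤ^θ × ℤ^θ → 𝕜ˣ` of the braiding matrix,
`q(u, v) = ∏_{j,k} q_{jk}^{u_j v_k}`. -/
noncomputable def qExt {θ : ℕ} {𝕜 : Type*} [Field 𝕜] (q : Fin θ → Fin θ → 𝕜)
    (u v : Fin θ → ℤ) : 𝕜 :=
  ∏ j, ∏ k, q j k ^ (u j * v k)

/-- The reflected braiding matrix `ρ_i(q)_{jk} = q(s_i^q(α_j), s_i^q(α_k))`. -/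
noncomputable def qReflect {θ : ℕ} {𝕜 : Type*} [Field 𝕜] (q : Fin θ → Fin θ → 𝕜)
    (i : Fin θ) : Fin θ → Fin θ → 𝕜 :=
  fun j k => qExt q (qRefl q i (Pi.single j 1)) (qRefl q i (Pi.single k 1))

theorem qExt_sum_left {θ : ℕ} {𝕜 ι : Type*} [Field 𝕜] {q : Fin θ → Fin θ → 𝕜}
    (hq : ∀ i j, q i j ≠ 0) (s : Finset ι) (a : ι → ℤ) (x : ι → Fin θ → ℤ) (v : Fin θ → ℤ) :
    qExt q (∑ l ∈ s, a l • x l) v = ∏ l ∈ s, qExt q (x l) v ^ a l := by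
  classical
  induction s using Finset.induction_on with
  | empty => simp [qExt]
  | insert l s hl ih =>
    rw [Finset.sum_insert hl, Finset.prod_insert hl, ← ih]
    simp only [qExt, ← Finset.prod_zpow, ← Finset.prod_mul_distrib]
    refine Finset.prod_congr rfl fun j _ => Finset.prod_congr rfl fun k _ => ?_
    rw [← zpow_mul, ← zpow_add₀ (hq j k)]
    congr 1
    simp only [Pi.add_apply, Pi.smul_apply, smul_eq_mul]
    ring

theorem qExt_sum_right {θ : ℕ} {𝕜 ι : Type*} [Field 𝕜] {q : Fin θ → Fin θ → 𝕜}
    (hq : ∀ i j, q i j ≠ 0) (s : Finset ι) (a : ι → ℤ) (x : ι → Fin θ → ℤ) (v : Fin θ → ℤ) :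
    qExt q v (∑ l ∈ s, a l • x l) = ∏ l ∈ s, qExt q v (x l) ^ a l := by
  classical
  induction s using Finset.induction_on with
  | empty => simp [qExt]
  | insert l s hl ih =>
    rw [Finset.sum_insert hl, Finset.prod_insert hl, ← ih]
    simp only [qExt, ← Finset.prod_zpow, ← Finset.prod_mul_distrib]
    refine Finset.prod_congr rfl fun j _ => Finset.prod_congr rfl fun k _ => ?_
    rw [← zpow_mul, ← zpow_add₀ (hq j k)]
    congr 1
    simp only [Pi.add_apply, Pi.smul_apply, smul_eq_mul]
    ring

theorem qExt_single {θ : ℕ} {𝕜 : Type*} [Field 𝕜] (q : Fin θ → Fin θ → 𝕜) (j k : Fin θ) :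
    qExt q (Pi.single j 1) (Pi.single k 1) = q j k := by
  rw [qExt, Finset.prod_eq_single j, Finset.prod_eq_single k]
  · simp
  · intro l _ hl
    simp [hl]
  · simp
  · intro l _ hl
    simp [hl]
  · simp

theorem qRefl_eq_sum {θ : ℕ} {𝕜 : Type*} [Field 𝕜] (q : Fin θ → Fin θ → 𝕜) (i : Fin θ)
    (v : Fin θ → ℤ) : qRefl q i v = ∑ j, v j • qRefl q i (Pi.single j 1) := by
  ext k
  simp [qRefl, Finset.sum_apply, Pi.single_apply, mul_sub, Finset.sum_sub_distrib]
  split_ifs <;> simp [mul_comm]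

theorem qExt_qReflect {θ : ℕ} {𝕜 : Type*} [Field 𝕜] {q : Fin θ → Fin θ → 𝕜}
    (hq : ∀ i j, q i j ≠ 0) (i : Fin θ) (u v : Fin θ → ℤ) :
    qExt (qReflect q i) u v = qExt q (qRefl q i u) (qRefl q i v) := by
  rw [qRefl_eq_sum q i u, qExt_sum_left hq]
  refine Finset.prod_congr rfl fun j _ => ?_
  rw [qRefl_eq_sum q i v, qExt_sum_right hq, ← Finset.prod_zpow]
  refine Finset.prod_congr rfl fun k _ => ?_
  rw [← zpow_mul, mul_comm (v k)]
  rfl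

theorem qRefl_involutive {θ : ℕ} {𝕜 : Type*} [Field 𝕜] (q : Fin θ → Fin θ → 𝕜) (i : Fin θ) :
    Function.Involutive (qRefl q i) := by
  intro v
  have h : ∑ j, qCartan q i j * qRefl q i v j = -∑ j, qCartan q i j * v j := by
    have hii : qCartan q i i = 2 := by simp [qCartan]
    simp only [qRefl, Pi.sub_apply, Pi.smul_apply, smul_eq_mul, mul_sub, Finset.sum_sub_distrib,
      Pi.single_apply, mul_ite, mul_one, mul_zero, Finset.sum_ite_eq', Finset.mem_univ, if_true,
      hii]
    ring
  rw [qRefl, h, qRefl]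
  module

/-- If `q` is an admissible braiding matrix, `ρ_i(q)` is again admissible, and
`c^{ρ_i(q)}_{ij} = c^q_{ij}` for all `j`, then `ρ_i(ρ_i(q)) = q`: the reflection `ρ_i` is an
involution. -/
theorem stmt12 {θ : ℕ} {𝕜 : Type*} [Field 𝕜] (q : Fin θ → Fin θ → 𝕜)
    (hq : ∀ i j, q i j ≠ 0) (i : Fin θ)
    (hadm : qAdmissible q) (hadm' : qAdmissible (qReflect q i))
    (hc : ∀ j, qCartan (qReflect q i) i j = qCartan q i j) :
    qReflect (qReflect q i) i = q := by
  have hs : qRefl (qReflect q i) i = qRefl q i := by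
    funext v
    simp only [qRefl, hc]
  funext j k
  rw [qReflect, hs, qExt_qReflect hq, qRefl_involutive q i, qRefl_involutive q i, qExt_single]
end
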